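/- Let A be a subring of a reduced commutative ring B such that B is a rational extension of A, let A⁺ be a partial ordering of A, and let B⁺ := { Σᵢ₌₁ⁿ aᵢ·bᵢ² : n ∈ ℕ, aᵢ ∈ A⁺, bᵢ ∈ B } be the weakest extension of A⁺ to B; assume B⁺ ∩ (−B⁺) = {0}, so that B⁺ is a partial ordering of B. Then the map P̃ ↦ P̃ ∩ A is a bijection from the set of maximal partial orderings of B containing B⁺ onto the set of maximal partial orderings of A containing A⁺. -/

import Mathlib

/-- A partial ordering of (the subring `S` of) a commutative ring `R`:
a subset `P ⊆ S` with `P + P ⊆ P`, `P·P ⊆ P`, `x² ∈ P` for all `x ∈ S`,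
and `P ∩ (−P) = {0}`. -/
def IsPartialOrderingOn {R : Type*} [CommRing R] (S : Subring R) (P : Set R) : Prop :=
  P ⊆ ↑S ∧ (∀ x ∈ P, ∀ y ∈ P, x + y ∈ P) ∧ (∀ x ∈ P, ∀ y ∈ P, x * y ∈ P) ∧
    (∀ x ∈ S, x ^ 2 ∈ P) ∧ ∀ x, x ∈ P → -x ∈ P → x = 0

/-- A maximal partial ordering: maximal w.r.t. inclusion among partial orderings. -/
def IsMaxPartialOrderingOn {R : Type*} [CommRing R] (S : Subring R) (P : Set R) : Prop :=
  IsPartialOrderingOn S P ∧ ∀ Q : Set R, IsPartialOrderingOn S Q → P ⊆ Q → Q = P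

namespace IsPartialOrderingOn

variable {R : Type*} [CommRing R] {S : Subring R} {P : Set R}

theorem subset_coe (h : IsPartialOrderingOn S P) : P ⊆ ↑S := h.1

theorem add_mem (h : IsPartialOrderingOn S P) {x y : R} (hx : x ∈ P) (hy : y ∈ P) :
    x + y ∈ P := h.2.1 x hx y hy

theorem mul_mem (h : IsPartialOrderingOn S P) {x y : R} (hx : x ∈ P) (hy : y ∈ P) :
    x * y ∈ P := h.2.2.1 x hx y hy

theorem sq_mem (h : IsPartialOrderingOn S P) {x : R} (hx : x ∈ S) : x ^ 2 ∈ P :=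
  h.2.2.2.1 x hx

theorem eq_zero (h : IsPartialOrderingOn S P) {x : R} (hx : x ∈ P) (hx' : -x ∈ P) : x = 0 :=
  h.2.2.2.2 x hx hx'

theorem zero_mem (h : IsPartialOrderingOn S P) : (0 : R) ∈ P := by
  simpa using h.sq_mem S.zero_mem

theorem one_mem (h : IsPartialOrderingOn S P) : (1 : R) ∈ P := by
  simpa using h.sq_mem S.one_mem

theorem sum_mem (h : IsPartialOrderingOn S P) {ι : Type*} (s : Finset ι) {f : ι → R}
    (hf : ∀ i ∈ s, f i ∈ P) : ∑ i ∈ s, f i ∈ P :=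
  Finset.sum_induction f (· ∈ P) (fun _ _ => h.add_mem) h.zero_mem hf

/-- A partial ordering of the whole ring restricts to any subring. -/
theorem inter (h : IsPartialOrderingOn (⊤ : Subring R) P) (A : Subring R) :
    IsPartialOrderingOn A (P ∩ ↑A) :=
  ⟨Set.inter_subset_right,
    fun _ hx _ hy => ⟨h.add_mem hx.1 hy.1, A.add_mem hx.2 hy.2⟩,
    fun _ hx _ hy => ⟨h.mul_mem hx.1 hy.1, A.mul_mem hx.2 hy.2⟩,
    fun _ hx => ⟨h.sq_mem trivial, A.pow_mem hx 2⟩,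
    fun _ hx hx' => h.eq_zero hx.1 hx'.1⟩

/-- Every partial ordering is contained in a maximal one. -/
theorem exists_isMax (h : IsPartialOrderingOn S P) :
    ∃ M, P ⊆ M ∧ IsMaxPartialOrderingOn S M := by
  obtain ⟨M, hPM, hM⟩ := zorn_subset_nonempty {Q : Set R | IsPartialOrderingOn S Q} (by
    intro c hc hchain ⟨Q₀, hQ₀⟩
    have join : ∀ x ∈ ⋃₀ c, ∀ y ∈ ⋃₀ c, ∃ Q ∈ c, x ∈ Q ∧ y ∈ Q := by
      rintro x ⟨Q, hQ, hx⟩ y ⟨Q', hQ', hy⟩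
      rcases hchain.total hQ hQ' with hle | hle
      · exact ⟨Q', hQ', hle hx, hy⟩
      · exact ⟨Q, hQ, hx, hle hy⟩
    refine ⟨⋃₀ c, ⟨?_, ?_, ?_, ?_, ?_⟩, fun s hs => Set.subset_sUnion_of_mem hs⟩
    · exact Set.sUnion_subset fun Q hQ => (hc hQ).subset_coe
    · intro x hx y hy
      obtain ⟨Q, hQ, hxQ, hyQ⟩ := join x hx y hy
      exact ⟨Q, hQ, (hc hQ).add_mem hxQ hyQ⟩
    · intro x hx y hy
      obtain ⟨Q, hQ, hxQ, hyQ⟩ := join x hx y hy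
      exact ⟨Q, hQ, (hc hQ).mul_mem hxQ hyQ⟩
    · exact fun x hx => ⟨Q₀, hQ₀, (hc hQ₀).sq_mem hx⟩
    · intro x hx hx'
      obtain ⟨Q, hQ, hxQ, hyQ⟩ := join x hx (-x) hx'
      exact (hc hQ).eq_zero hxQ hyQ) P h
  exact ⟨M, hPM, hM.prop, fun Q hQ hMQ => (hM.eq_of_subset hQ hMQ).symm⟩

/-- In a reduced ring, `P + xP` is a partial ordering as soon as no product of `x` with an
element of `P` is nonzero and negative. -/
theorem adjoin [IsReduced R] (h : IsPartialOrderingOn S P) {x : R} (hxS : x ∈ S)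
    (hx : ∀ t ∈ P, -(x * t) ∈ P → x * t = 0) :
    IsPartialOrderingOn S {z | ∃ p ∈ P, ∃ q ∈ P, z = p + x * q} := by
  refine ⟨?_, ?_, ?_, ?_, ?_⟩
  · rintro _ ⟨p, hp, q, hq, rfl⟩
    exact S.add_mem (h.subset_coe hp) (S.mul_mem hxS (h.subset_coe hq))
  · rintro _ ⟨p, hp, q, hq, rfl⟩ _ ⟨p', hp', q', hq', rfl⟩
    exact ⟨p + p', h.add_mem hp hp', q + q', h.add_mem hq hq', by ring⟩
  · rintro _ ⟨p, hp, q, hq, rfl⟩ _ ⟨p', hp', q', hq', rfl⟩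
    exact ⟨p * p' + x ^ 2 * (q * q'),
      h.add_mem (h.mul_mem hp hp') (h.mul_mem (h.sq_mem hxS) (h.mul_mem hq hq')),
      p * q' + q * p', h.add_mem (h.mul_mem hp hq') (h.mul_mem hq hp'), by ring⟩
  · exact fun y hy => ⟨y ^ 2, h.sq_mem hy, 0, h.zero_mem, by ring⟩
  · rintro _ ⟨p, hp, q, hq, rfl⟩ ⟨p', hp', q', hq', hneg⟩
    have hsum : -(x * (q + q')) = p + p' := by linear_combination hneg
    have hxq : x * (q + q') = 0 :=
      hx _ (h.add_mem hq hq') (hsum ▸ h.add_mem hp hp')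
    have hp0 : p = 0 := h.eq_zero hp (by
      have : -p = p' := by linear_combination hsum + hxq
      exact this ▸ hp')
    have hsq : x ^ 2 * (q * q) = 0 :=
      h.eq_zero (h.mul_mem (h.sq_mem hxS) (h.mul_mem hq hq)) (by
        have : -(x ^ 2 * (q * q)) = x ^ 2 * (q * q') := by
          linear_combination -(x * q) * hxq
        exact this ▸ h.mul_mem (h.sq_mem hxS) (h.mul_mem hq hq'))
    have hxq0 : x * q = 0 := eq_zero_of_pow_eq_zero (n := 2) (by linear_combination hsq)
    rw [hp0, hxq0, add_zero]

/-- Along a rational extension, a partial ordering `Q` of the subring extends to the set of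
all elements that are moved into `Q` by sufficiently many squares of elements of the subring. -/
theorem extend [IsReduced R] {A : Subring R}
    (hrat : ∀ b b' : R, b' ≠ 0 → ∃ a ∈ A, a * b ∈ A ∧ a * b' ≠ 0)
    {Q : Set R} (hQ : IsPartialOrderingOn A Q) :
    IsPartialOrderingOn (⊤ : Subring R)
      {x | ∀ b : R, b ≠ 0 → ∃ a ∈ A, a * b ≠ 0 ∧ a ^ 2 * x ∈ Q} := by
  have common : ∀ {x y : R}, (∀ b : R, b ≠ 0 → ∃ a ∈ A, a * b ≠ 0 ∧ a ^ 2 * x ∈ Q) →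
      (∀ b : R, b ≠ 0 → ∃ a ∈ A, a * b ≠ 0 ∧ a ^ 2 * y ∈ Q) → ∀ b : R, b ≠ 0 →
      ∃ a ∈ A, ∃ a' ∈ A, a' * a * b ≠ 0 ∧ a ^ 2 * x ∈ Q ∧ a' ^ 2 * y ∈ Q := by
    intro x y hx hy b hb
    obtain ⟨a, haA, hab, hax⟩ := hx b hb
    obtain ⟨a', haA', hab', hay⟩ := hy _ hab
    exact ⟨a, haA, a', haA', by rwa [mul_assoc], hax, hay⟩
  refine ⟨fun _ _ => trivial, ?_, ?_, ?_, ?_⟩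
  · intro x hx y hy b hb
    obtain ⟨a, haA, a', haA', hne, hax, hay⟩ := common hx hy b hb
    refine ⟨a' * a, A.mul_mem haA' haA, hne, ?_⟩
    have : (a' * a) ^ 2 * (x + y) = a' ^ 2 * (a ^ 2 * x) + a ^ 2 * (a' ^ 2 * y) := by ring
    rw [this]
    exact hQ.add_mem (hQ.mul_mem (hQ.sq_mem haA') hax) (hQ.mul_mem (hQ.sq_mem haA) hay)
  · intro x hx y hy b hb
    obtain ⟨a, haA, a', haA', hne, hax, hay⟩ := common hx hy b hb
    refine ⟨a' * a, A.mul_mem haA' haA, hne, ?_⟩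
    have : (a' * a) ^ 2 * (x * y) = (a ^ 2 * x) * (a' ^ 2 * y) := by ring
    rw [this]
    exact hQ.mul_mem hax hay
  · intro x _ b hb
    obtain ⟨a, haA, hax, hab⟩ := hrat x b hb
    exact ⟨a, haA, hab, by simpa only [mul_pow] using hQ.sq_mem hax⟩
  · intro x hx hx'
    by_contra hne
    obtain ⟨a, haA, a', haA', haa, hax, hax'⟩ := common hx hx' x hne
    have hzero : a' ^ 2 * (a ^ 2 * x) = 0 :=
      hQ.eq_zero (hQ.mul_mem (hQ.sq_mem haA') hax) (by
        have : -(a' ^ 2 * (a ^ 2 * x)) = a ^ 2 * (a' ^ 2 * -x) := by ring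
        exact this ▸ hQ.mul_mem (hQ.sq_mem haA) hax')
    exact haa (eq_zero_of_pow_eq_zero (n := 2) (by linear_combination x * hzero))

end IsPartialOrderingOn

namespace IsMaxPartialOrderingOn

variable {R : Type*} [CommRing R] [IsReduced R] {P : Set R}

/-- An element outside a maximal partial ordering `P` has a nonzero negative product with some
element of `P`. -/
theorem exists_neg_mul_mem {S : Subring R} (h : IsMaxPartialOrderingOn S P) {x : R}
    (hxS : x ∈ S) (hx : x ∉ P) : ∃ t ∈ P, -(x * t) ∈ P ∧ x * t ≠ 0 := by
  by_contra! hcon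
  refine hx ?_
  rw [← h.2 _ (h.1.adjoin hxS hcon) fun p hp => ⟨p, hp, 0, h.1.zero_mem, by ring⟩]
  exact ⟨0, h.1.zero_mem, 1, h.1.one_mem, by ring⟩

/-- If the ring is a rational extension of `A`, the witness in `exists_neg_mul_mem` can be chosen
in `A`. -/
theorem exists_mem_subring_neg_mul_mem {A : Subring R}
    (hrat : ∀ b b' : R, b' ≠ 0 → ∃ a ∈ A, a * b ∈ A ∧ a * b' ≠ 0)
    (h : IsMaxPartialOrderingOn (⊤ : Subring R) P) {x : R} (hx : x ∉ P) :
    ∃ t ∈ P ∩ ↑A, -(x * t) ∈ P ∧ x * t ≠ 0 := by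
  obtain ⟨t, htP, hxt, hne⟩ := h.exists_neg_mul_mem trivial hx
  obtain ⟨a, haA, hat, hane⟩ := hrat t _ hne
  have hsq : a ^ 2 ∈ P := h.1.sq_mem trivial
  refine ⟨a ^ 2 * t, ⟨h.1.mul_mem hsq htP, ?_⟩, ?_, fun hzero => hane ?_⟩
  · rw [sq, mul_assoc]
    exact A.mul_mem haA hat
  · have : -(x * (a ^ 2 * t)) = a ^ 2 * -(x * t) := by ring
    exact this ▸ h.1.mul_mem hsq hxt
  · exact eq_zero_of_pow_eq_zero (n := 2) (by linear_combination x * t * hzero)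

theorem inter {A : Subring R}
    (hrat : ∀ b b' : R, b' ≠ 0 → ∃ a ∈ A, a * b ∈ A ∧ a * b' ≠ 0)
    (h : IsMaxPartialOrderingOn (⊤ : Subring R) P) : IsMaxPartialOrderingOn A (P ∩ ↑A) := by
  refine ⟨h.1.inter A, fun Q hQ hPQ => Set.Subset.antisymm (fun x hxQ => ?_) hPQ⟩
  have hxA := hQ.subset_coe hxQ
  refine ⟨by_contra fun hxP => ?_, hxA⟩
  obtain ⟨t, ht, hneg, hne⟩ := h.exists_mem_subring_neg_mul_mem hrat hxP
  exact hne (hQ.eq_zero (hQ.mul_mem hxQ (hPQ ht))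
    (hPQ ⟨hneg, A.neg_mem (A.mul_mem hxA ht.2)⟩))

theorem subset_of_inter_eq {A : Subring R}
    (hrat : ∀ b b' : R, b' ≠ 0 → ∃ a ∈ A, a * b ∈ A ∧ a * b' ≠ 0) {P' : Set R}
    (h : IsPartialOrderingOn (⊤ : Subring R) P) (h' : IsMaxPartialOrderingOn (⊤ : Subring R) P')
    (heq : P ∩ ↑A = P' ∩ ↑A) : P ⊆ P' := by
  intro x hxP
  by_contra hxP'
  obtain ⟨t, ht, hneg, hne⟩ := h'.exists_mem_subring_neg_mul_mem hrat hxP'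
  obtain ⟨c, hcA, hcxt, hcne⟩ := hrat _ _ hne
  have htP : t ∈ P := (heq ▸ ht : t ∈ P ∩ ↑A).1
  have hmem : c ^ 2 * -(x * t) ∈ P ∩ ↑A := by
    rw [heq]
    refine ⟨h'.1.mul_mem (h'.1.sq_mem trivial) hneg, ?_⟩
    have : c ^ 2 * -(x * t) = -(c * (c * (x * t))) := by ring
    rw [this]
    exact A.neg_mem (A.mul_mem hcA hcxt)
  have hzero : c ^ 2 * (x * t) = 0 :=
    h.eq_zero (h.mul_mem (h.sq_mem trivial) (h.mul_mem hxP htP)) (by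
      rw [← mul_neg]
      exact hmem.1)
  exact hcne (eq_zero_of_pow_eq_zero (n := 2) (by linear_combination x * t * hzero))

end IsMaxPartialOrderingOn

/-- Let `A` be a subring of a reduced commutative ring `B` such that `B` is a rational
extension of `A`, let `A⁺` be a partial ordering of `A`, and let
`B⁺ = { Σ aᵢbᵢ² : aᵢ ∈ A⁺, bᵢ ∈ B }` be the weakest extension of `A⁺` to `B`;
assume `B⁺ ∩ (−B⁺) = {0}` (so `B⁺` is a partial ordering of `B`).  Then `P̃ ↦ P̃ ∩ A` is
a bijection from the maximal partial orderings of `B` containing `B⁺` onto the maximal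
partial orderings of `A` containing `A⁺`. -/
theorem bijOn_maxPartialOrdering_extending {B : Type*} [CommRing B] [IsReduced B]
    (A : Subring B)
    (hrat : ∀ b b' : B, b' ≠ 0 → ∃ a ∈ A, a * b ∈ A ∧ a * b' ≠ 0)
    (Aplus : Set B) (hAplus : IsPartialOrderingOn A Aplus)
    (Bplus : Set B)
    (hBplus : Bplus = {x : B | ∃ (n : ℕ) (a : Fin n → B) (b : Fin n → B),
        (∀ i, a i ∈ Aplus) ∧ x = ∑ i, a i * b i ^ 2})
    (hprop : ∀ x, x ∈ Bplus → -x ∈ Bplus → x = 0) :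
    Set.BijOn (fun P : Set B => P ∩ ↑A)
      {P : Set B | IsMaxPartialOrderingOn (⊤ : Subring B) P ∧ Bplus ⊆ P}
      {Q : Set B | IsMaxPartialOrderingOn A Q ∧ Aplus ⊆ Q} := by
  have hsub : Aplus ⊆ Bplus := by
    intro x hx
    rw [hBplus]
    exact ⟨1, fun _ => x, fun _ => 1, fun _ => hx, by simp⟩
  refine ⟨?_, ?_, ?_⟩
  · rintro P ⟨hP, hBP⟩
    exact ⟨hP.inter hrat, fun x hx => ⟨hBP (hsub hx), hAplus.subset_coe hx⟩⟩
  · rintro P ⟨hP, -⟩ P' ⟨hP', -⟩ heq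
    exact (IsMaxPartialOrderingOn.subset_of_inter_eq hrat hP.1 hP' heq).antisymm
      (IsMaxPartialOrderingOn.subset_of_inter_eq hrat hP'.1 hP heq.symm)
  · rintro Q ⟨hQ, hAQ⟩
    obtain ⟨P, hleP, hP⟩ := (hQ.1.extend hrat).exists_isMax
    have hQP : Q ⊆ P := fun x hx => hleP fun b hb => ⟨1, A.one_mem, by simpa, by simpa⟩
    refine ⟨P, ⟨hP, ?_⟩, hQ.2 _ (hP.1.inter A) fun x hx => ⟨hQP hx, hQ.1.subset_coe hx⟩⟩
    rw [hBplus]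
    rintro _ ⟨n, a, b, ha, rfl⟩
    exact hP.1.sum_mem _ fun i _ =>
      hP.1.mul_mem (hQP (hAQ (ha i))) (hP.1.sq_mem trivial)
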